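/- arXiv:1602.00045 — 4 statements merged into one kernel-verified Lean document; each statement's English description precedes it below -/
import Mathlib

section
/- Let X be a metric space, let A, B ⊂ X be two disjoint closed sets, and let K ⊂ X be a compact set that intersects both A and B. If K does not contain a connected component K0 which intersects both A and B, then there exist two disjoint open sets V1 and V2 such that A ⊂ V1, B ⊂ V2, and (A ∪ B ∪ K) ⊂ (V1 ∪ V2). -/
/-- In a compact Hausdorff space, two closed sets that no connected component joins are
separated by a clopen set. -/
theorem exists_isClopen_of_forall_connectedComponent {Y : Type*} [TopologicalSpace Y]
    [CompactSpace Y] [T2Space Y] {S T : Set Y} (hS : IsClosed S) (hT : IsClosed T)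
    (h : ∀ x, (connectedComponent x ∩ S).Nonempty → ¬ (connectedComponent x ∩ T).Nonempty) :
    ∃ C : Set Y, IsClopen C ∧ S ⊆ C ∧ Disjoint C T := by
  have hcont : Continuous ((↑) : Y → ConnectedComponents Y) := ConnectedComponents.continuous_coe
  have hS' : IsClosed (((↑) : Y → ConnectedComponents Y) '' S) :=
    (hS.isCompact.image hcont).isClosed
  have hT' : IsClosed (((↑) : Y → ConnectedComponents Y) '' T) :=
    (hT.isCompact.image hcont).isClosed
  have hST : (((↑) : Y → ConnectedComponents Y) '' S) ⊆
      (((↑) : Y → ConnectedComponents Y) '' T)ᶜ := by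
    rintro _ ⟨s, hs, rfl⟩ ⟨t, ht, hts⟩
    rw [ConnectedComponents.coe_eq_coe] at hts
    exact h s ⟨s, mem_connectedComponent, hs⟩ ⟨t, hts ▸ mem_connectedComponent, ht⟩
  obtain ⟨C, hC, hSC, hCT⟩ :=
    exists_clopen_of_closed_subset_open hS' hT'.isOpen_compl hST
  refine ⟨_, hC.preimage hcont, Set.image_subset_iff.1 hSC, ?_⟩
  exact Set.disjoint_left.2 fun y hy hyT => hCT hy ⟨y, hyT, rfl⟩

/-- **Kuratowski's separation lemma.**  Let `X` be a metric space, `A, B ⊆ X` disjoint closed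
sets, and `K ⊆ X` a compact set meeting both `A` and `B`.  If no connected component of `K`
meets both `A` and `B`, then there are disjoint open sets `V1 ⊇ A`, `V2 ⊇ B` with
`A ∪ B ∪ K ⊆ V1 ∪ V2`. -/
theorem kuratowski_separation {X : Type*} [MetricSpace X] (A B K : Set X)
    (hA : IsClosed A) (hB : IsClosed B) (hAB : Disjoint A B)
    (hK : IsCompact K) (hKA : (K ∩ A).Nonempty) (hKB : (K ∩ B).Nonempty)
    (hcomp : ¬ ∃ x ∈ K, (connectedComponentIn K x ∩ A).Nonempty ∧
        (connectedComponentIn K x ∩ B).Nonempty) :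
    ∃ V1 V2 : Set X, IsOpen V1 ∧ IsOpen V2 ∧ Disjoint V1 V2 ∧
      A ⊆ V1 ∧ B ⊆ V2 ∧ A ∪ B ∪ K ⊆ V1 ∪ V2 := by
  have : CompactSpace K := isCompact_iff_compactSpace.1 hK
  obtain ⟨C, hC, hAC, hCB⟩ := exists_isClopen_of_forall_connectedComponent
    (hA.preimage (continuous_subtype_val (p := (· ∈ K))))
    (hB.preimage (continuous_subtype_val (p := (· ∈ K)))) (by
      rintro x ⟨a, hax, ha⟩ ⟨b, hbx, hb⟩
      refine hcomp ⟨x, x.2, ?_⟩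
      rw [connectedComponentIn_eq_image x.2]
      exact ⟨⟨a, ⟨a, hax, rfl⟩, ha⟩, ⟨b, ⟨b, hbx, rfl⟩, hb⟩⟩)
  have hC₁ : IsClosed (((↑) : K → X) '' C) :=
    (hC.isClosed.isCompact.image continuous_subtype_val).isClosed
  have hC₂ : IsClosed (((↑) : K → X) '' Cᶜ) :=
    (hC.compl.isClosed.isCompact.image continuous_subtype_val).isClosed
  have hdisj : Disjoint (A ∪ (↑) '' C) (B ∪ ((↑) : K → X) '' Cᶜ) := by
    rw [Set.disjoint_left]
    rintro _ (ha | ⟨y, hy, rfl⟩) (hb | ⟨z, hz, hzy⟩)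
    · exact Set.disjoint_left.1 hAB ha hb
    · exact hz (hAC (show (z : X) ∈ A from hzy ▸ ha))
    · exact Set.disjoint_left.1 hCB hy hb
    · exact hz (Subtype.ext hzy ▸ hy)
  obtain ⟨V1, V2, hV1, hV2, h1, h2, hV⟩ := normal_separation (hA.union hC₁) (hB.union hC₂) hdisj
  have hAV : A ⊆ V1 := Set.subset_union_left.trans h1
  have hBV : B ⊆ V2 := Set.subset_union_left.trans h2
  refine ⟨V1, V2, hV1, hV2, hV, hAV, hBV, Set.union_subset (Set.union_subset_union hAV hBV) ?_⟩
  intro x hx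
  by_cases hxC : (⟨x, hx⟩ : K) ∈ C
  · exact Or.inl (h1 (Or.inr ⟨_, hxC, rfl⟩))
  · exact Or.inr (h2 (Or.inr ⟨_, hxC, rfl⟩))
end

section
/- Let W be a real Banach space and C : ℝ × W → W a continuous map such that: (i) C(α, 0) = 0 for all α ∈ ℝ; (ii) for every α ∈ ℝ the Fréchet derivative A(α) := D_u C(α, 0) exists, is a compact linear operator, and α ↦ A(α) is continuous in the operator norm; (iii) for all a < b, sup_{α ∈ [a,b]} ‖C(α,u) − A(α)u‖ / ‖u‖ → 0 as ‖u‖ → 0. Suppose there is a sequence (α_n, u_n) ∈ ℝ × W with u_n ≠ 0 and u_n = C(α_n, u_n) for all n, converging to (α₀, 0). Then the operator Id − A(α₀) is not injective; i.e., there exists v ∈ W, v ≠ 0, with v = A(α₀) v. -/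
open Filter Topology

/-- A compact operator having a sequence of approximately fixed unit vectors has a nonzero
fixed vector. -/
theorem IsCompactOperator.exists_ne_zero_eq_apply_of_tendsto_sub
    {W : Type*} [NormedAddCommGroup W] [NormedSpace ℝ W] {T : W →L[ℝ] W}
    (hT : IsCompactOperator T) {v : ℕ → W} (hv : ∀ n, ‖v n‖ = 1)
    (h : Tendsto (fun n => v n - T (v n)) atTop (𝓝 0)) :
    ∃ x : W, x ≠ 0 ∧ x = T x := by
  obtain ⟨K, hK, hTK⟩ := IsCompactOperator.image_closedBall_subset_compact
    (f := (T : W →ₗ[ℝ] W)) hT 1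
  obtain ⟨x, -, φ, hφ, hx⟩ := hK.tendsto_subseq (x := fun n => T (v n))
    fun n => hTK ⟨v n, by simp [hv n], rfl⟩
  have hvx : Tendsto (fun n => v (φ n)) atTop (𝓝 x) := by
    simpa using (h.comp hφ.tendsto_atTop).add hx
  refine ⟨x, ?_, tendsto_nhds_unique hx ((T.continuous.tendsto x).comp hvx)⟩
  have hnorm : ‖x‖ = 1 := tendsto_nhds_unique hvx.norm (by simp [hv])
  exact norm_ne_zero_iff.mp (by simp [hnorm])

/-- **Necessary condition for bifurcation.**  Let `W` be a real Banach space and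
`C : ℝ × W → W` continuous with `C (α, 0) = 0`, whose derivative in `u` at `0`, `A α`, exists,
is a compact operator depending norm-continuously on `α`, and approximates `C` uniformly on
compact parameter intervals.  If a sequence `(αₙ, uₙ)` of nontrivial fixed points
`uₙ = C (αₙ, uₙ)`, `uₙ ≠ 0`, converges to `(α₀, 0)`, then `Id - A α₀` is not injective:
there is `v ≠ 0` with `v = A α₀ v`. -/
theorem bifurcation_necessary_condition
    {W : Type*} [NormedAddCommGroup W] [NormedSpace ℝ W] [CompleteSpace W]
    (C : ℝ × W → W) (hC : Continuous C)
    (hC0 : ∀ α : ℝ, C (α, 0) = 0)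
    (A : ℝ → W →L[ℝ] W)
    (hderiv : ∀ α : ℝ, HasFDerivAt (fun u => C (α, u)) (A α) 0)
    (hcpt : ∀ α : ℝ, IsCompactOperator (A α))
    (hAcont : Continuous A)
    (happrox : ∀ a b : ℝ, a < b → ∀ ε > (0 : ℝ), ∃ δ > (0 : ℝ), ∀ u : W, u ≠ 0 → ‖u‖ < δ →
      ∀ α ∈ Set.Icc a b, ‖C (α, u) - A α u‖ / ‖u‖ < ε)
    (α₀ : ℝ) (αs : ℕ → ℝ) (us : ℕ → W)
    (hne : ∀ n, us n ≠ 0) (hfix : ∀ n, us n = C (αs n, us n))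
    (hconv : Tendsto (fun n => (αs n, us n)) atTop (𝓝 (α₀, (0 : W)))) :
    ∃ v : W, v ≠ 0 ∧ v = A α₀ v := by
  have hα : Tendsto αs atTop (𝓝 α₀) := (continuous_fst.tendsto _).comp hconv
  have hu : Tendsto us atTop (𝓝 0) := (continuous_snd.tendsto _).comp hconv
  refine (hcpt α₀).exists_ne_zero_eq_apply_of_tendsto_sub (v := fun n => ‖us n‖⁻¹ • us n)
    (fun n => norm_smul_inv_norm (𝕜 := ℝ) (hne n)) ?_
  have hrem : Tendsto (fun n => ‖C (αs n, us n) - A (αs n) (us n)‖ / ‖us n‖) atTop (𝓝 0) := by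
    rw [Metric.tendsto_atTop']
    intro ε hε
    obtain ⟨δ, hδ, hδε⟩ := happrox (α₀ - 1) (α₀ + 1) (by linarith) ε hε
    have hmem : ∀ᶠ n in atTop, αs n ∈ Set.Icc (α₀ - 1) (α₀ + 1) :=
      hα (Icc_mem_nhds (by linarith) (by linarith))
    have hsmall : ∀ᶠ n in atTop, us n ∈ Metric.ball 0 δ := hu (Metric.ball_mem_nhds 0 hδ)
    obtain ⟨N, hN⟩ := eventually_atTop.mp (hmem.and hsmall)
    refine ⟨N, fun n hn => ?_⟩
    obtain ⟨hn₁, hn₂⟩ := hN n hn.le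
    rw [Real.dist_0_eq_abs, abs_of_nonneg (by positivity)]
    exact hδε _ (hne n) (mem_ball_zero_iff.mp hn₂) _ hn₁
  have hA : Tendsto (fun n => ‖A (αs n) - A α₀‖) atTop (𝓝 0) :=
    tendsto_iff_norm_sub_tendsto_zero.mp ((hAcont.tendsto α₀).comp hα)
  refine squeeze_zero_norm (fun n => ?_) (by simpa using hrem.add hA)
  have hpos : 0 < ‖us n‖ := norm_pos_iff.mpr (hne n)
  rw [← hfix n, map_smul, ← smul_sub, norm_smul, norm_inv, norm_norm, inv_mul_le_iff₀ hpos,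
    mul_add, mul_div_cancel₀ _ hpos.ne', mul_comm ‖us n‖]
  calc ‖us n - A α₀ (us n)‖
      = ‖(us n - A (αs n) (us n)) + (A (αs n) - A α₀) (us n)‖ := by simp
    _ ≤ ‖us n - A (αs n) (us n)‖ + ‖A (αs n) - A α₀‖ * ‖us n‖ :=
      norm_add_le_of_le le_rfl (ContinuousLinearMap.le_opNorm _ _)
end

section
/- Let W be a real Banach space and C : ℝ × W → W a continuous map such that: (i) C(α, 0) = 0 for all α ∈ ℝ; (ii) for every α ∈ ℝ the Fréchet derivative A(α) := D_u C(α, 0) exists, is a compact linear operator, and α ↦ A(α) is continuous in the operator norm; (iii) for all a < b, sup_{α ∈ [a,b]} ‖C(α,u) − A(α)u‖ / ‖u‖ → 0 as ‖u‖ → 0. If for some α* ∈ ℝ the operator Id − A(α*) is injective, then there exists r > 0 such that for every u ∈ W with 0 < ‖u‖ ≤ r one has u ≠ C(α*, u); i.e., 0 is an isolated fixed point of C(α*, ·). -/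
/-- If, under the standing assumptions on `C : ℝ × W → W` (trivial branch of equilibria,
differentiability at `0` with compact derivative `A α` depending continuously on `α`, and
uniform smallness of the remainder), the operator `Id - A α*` is injective for some `α*`,
then `0` is an isolated fixed point of `C (α*, ·)`: there is `r > 0` such that
`u ≠ C (α*, u)` whenever `0 < ‖u‖ ≤ r`. -/
theorem isolated_trivial_solution
    {W : Type*} [NormedAddCommGroup W] [NormedSpace ℝ W] [CompleteSpace W]
    (C : ℝ × W → W) (hC : Continuous C)
    (hC0 : ∀ α : ℝ, C (α, 0) = 0)
    (A : ℝ → W →L[ℝ] W)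
    (hderiv : ∀ α : ℝ, HasFDerivAt (fun u => C (α, u)) (A α) 0)
    (hcpt : ∀ α : ℝ, IsCompactOperator (A α))
    (hAcont : Continuous A)
    (happrox : ∀ a b : ℝ, a < b → ∀ ε > (0 : ℝ), ∃ δ > (0 : ℝ), ∀ u : W, u ≠ 0 → ‖u‖ < δ →
      ∀ α ∈ Set.Icc a b, ‖C (α, u) - A α u‖ / ‖u‖ < ε)
    (αstar : ℝ)
    (hinj : Function.Injective (fun v : W => v - A αstar v)) :
    ∃ r > (0 : ℝ), ∀ u : W, 0 < ‖u‖ → ‖u‖ ≤ r → u ≠ C (αstar, u) := by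
  have h_eig : ¬ Module.End.HasEigenvalue (A αstar : Module.End ℝ W) 1 := by
    intro h
    obtain ⟨v, hv⟩ := h.exists_hasEigenvector
    have hfix : A αstar v = v := by simpa using hv.apply_eq_smul
    exact hv.2 (hinj (by simp [hfix]))
  obtain ⟨c, hc, hlow⟩ := antilipschitzWith_iff_exists_mul_le_norm.1
    ((hcpt αstar).antilipschitz_of_not_hasEigenvalue one_ne_zero h_eig)
  obtain ⟨δ, hδ, hsmall⟩ := happrox αstar (αstar + 1) (by linarith) c hc
  refine ⟨δ / 2, half_pos hδ, fun u hu hur hfix => ?_⟩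
  have hrem := hsmall u (norm_pos_iff.1 hu) (by linarith) αstar ⟨le_rfl, by linarith⟩
  rw [← hfix, div_lt_iff₀ hu, norm_sub_rev] at hrem
  have hbound : c * ‖u‖ ≤ ‖A αstar u - u‖ := by simpa using hlow u
  exact hbound.not_gt hrem
end

section
/- Let B be the 8 × 8 matrix with rows (−3,1,0,1,1,0,0,0), (1,−3,1,0,0,1,0,0), (0,1,−3,1,0,0,1,0), (1,0,1,−3,0,0,0,1), (1,0,0,0,−3,1,0,1), (0,1,0,0,1,−3,1,0), (0,0,1,0,0,1,−3,1), (0,0,0,1,1,0,1,−3). Let c₁, c₂, α ∈ ℝ, let l ≥ 1 be an integer, set M := c₁·Id₈ + c₂·B + 2cos(lα)·Id₈, and let A_l be the 16 × 16 complex matrix given in 8 × 8 blocks by A_l = [[Id, −(1/(i·l))·Id], [−(1/(i·l))·M, Id]]. Then λ ∈ ℂ is an eigenvalue of A_l if and only if l²·(1 − λ)² = −c₁ + 2k·c₂ − 2cos(lα) for some k ∈ {0, 1, 2, 3}. -/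
open Complex Matrix

/-- The coupling matrix of the cube-symmetric network of 8 oscillators (over `ℂ`). -/
def cubeB : Matrix (Fin 8) (Fin 8) ℂ :=
  !![-3,  1,  0,  1,  1,  0,  0,  0;
      1, -3,  1,  0,  0,  1,  0,  0;
      0,  1, -3,  1,  0,  0,  1,  0;
      1,  0,  1, -3,  0,  0,  0,  1;
      1,  0,  0,  0, -3,  1,  0,  1;
      0,  1,  0,  0,  1, -3,  1,  0;
      0,  0,  1,  0,  0,  1, -3,  1;
      0,  0,  0,  1,  1,  0,  1, -3]

/-- `M = c₁·Id + c₂·B + 2cos(lα)·Id` for the MDDE network. -/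
noncomputable def mddeM (c₁ c₂ α : ℝ) (l : ℕ) : Matrix (Fin 8) (Fin 8) ℂ :=
  (c₁ : ℂ) • (1 : Matrix (Fin 8) (Fin 8) ℂ) + (c₂ : ℂ) • cubeB +
    ((2 * Real.cos (l * α) : ℝ) : ℂ) • (1 : Matrix (Fin 8) (Fin 8) ℂ)

/-- The linearization `A_l = [[Id, -(1/(il))·Id], [-(1/(il))·M, Id]]` of the MDDE network on
the `l`-th Fourier mode. -/
noncomputable def mddeAl (c₁ c₂ α : ℝ) (l : ℕ) :
    Matrix (Fin 8 ⊕ Fin 8) (Fin 8 ⊕ Fin 8) ℂ :=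
  Matrix.fromBlocks 1 (-(1 / (Complex.I * (l : ℂ))) • (1 : Matrix (Fin 8) (Fin 8) ℂ))
    (-(1 / (Complex.I * (l : ℂ))) • mddeM c₁ c₂ α l) 1

/-- The character table of the group `(ℤ/2)³` of cube vertices, in the ordering of `cubeB`. -/
def cubeHadamard : Matrix (Fin 8) (Fin 8) ℤ :=
  !![1,  1,  1,  1,  1,  1,  1,  1;
     1, -1, -1,  1,  1, -1, -1,  1;
     1, -1,  1, -1,  1, -1,  1, -1;
     1,  1, -1, -1,  1,  1, -1, -1;
     1,  1,  1,  1, -1, -1, -1, -1;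
     1, -1, -1,  1, -1,  1,  1, -1;
     1, -1,  1, -1, -1,  1, -1,  1;
     1,  1, -1, -1, -1, -1,  1,  1]

/-- The number of nonzero coordinates of a cube vertex, in the ordering of `cubeB`. -/
def cubeWeight : Fin 8 → Fin 4 := ![0, 1, 2, 1, 1, 2, 3, 2]

theorem cubeWeight_surjective : Function.Surjective cubeWeight := by decide

theorem cubeHadamard_mul_self : cubeHadamard * cubeHadamard = diagonal fun _ => 8 := by
  ext i j
  fin_cases i <;> fin_cases j <;> rfl

theorem det_cubeHadamard_ne_zero : cubeHadamard.det ≠ 0 := by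
  intro h
  have h' := congrArg det cubeHadamard_mul_self
  rw [det_mul, h, det_diagonal] at h'
  norm_num at h'

theorem cubeB_mul_cubeHadamard :
    cubeB * cubeHadamard.map (Int.cast : ℤ → ℂ) =
      cubeHadamard.map (Int.cast : ℤ → ℂ) *
        diagonal fun i => -2 * (((cubeWeight i : Fin 4) : ℕ) : ℂ) := by
  ext i j
  rw [mul_diagonal]
  fin_cases i <;> fin_cases j <;>
    norm_num [cubeB, cubeHadamard, cubeWeight, Matrix.mul_apply, Fin.sum_univ_succ]

theorem det_smul_one_add_smul_cubeB (x c : ℂ) :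
    (x • (1 : Matrix (Fin 8) (Fin 8) ℂ) + c • cubeB).det =
      ∏ i, (x - 2 * (((cubeWeight i : Fin 4) : ℕ) : ℂ) * c) := by
  set P := cubeHadamard.map (Int.cast : ℤ → ℂ)
  have hP : P.det ≠ 0 := by
    rw [← Int.cast_det]
    exact_mod_cast det_cubeHadamard_ne_zero
  have h : (x • (1 : Matrix (Fin 8) (Fin 8) ℂ) + c • cubeB) * P =
      P * diagonal fun i => x - 2 * (((cubeWeight i : Fin 4) : ℕ) : ℂ) * c := by
    rw [add_mul, smul_mul_assoc, smul_mul_assoc, one_mul, cubeB_mul_cubeHadamard]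
    ext i j
    simp only [Matrix.add_apply, Matrix.smul_apply, mul_diagonal, smul_eq_mul, P]
    ring
  have h' := congrArg det h
  rw [det_mul, det_mul, det_diagonal, mul_comm] at h'
  exact mul_left_cancel₀ hP h'

/-- A block matrix with scalar diagonal blocks and invertible scalar upper right block is singular
exactly when its formal `2 × 2` determinant is. -/
theorem det_fromBlocks_smul_one_eq_zero_iff {n K : Type*} [Fintype n] [DecidableEq n] [Field K]
    {d s : K} (hs : s ≠ 0) (M : Matrix n n K) :
    (fromBlocks (d • 1) (s • 1) (s • M) (d • 1)).det = 0 ↔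
      (d ^ 2 • (1 : Matrix n n K) - s ^ 2 • M).det = 0 := by
  have h : fromBlocks (d • 1) (s • 1) (s • M) (d • 1) *
      fromBlocks (1 : Matrix n n K) 0 (-(d / s) • 1) 1 *
      (fromBlocks 0 1 1 0 : Matrix (n ⊕ n) (n ⊕ n) K) =
      fromBlocks (s • 1) 0 (d • 1) (-s⁻¹ • (d ^ 2 • (1 : Matrix n n K) - s ^ 2 • M)) := by
    simp only [fromBlocks_multiply]
    congr 1
    all_goals
      ext i j
      simp
      try field_simp
      try ring
  have h2 : (fromBlocks 0 1 1 0 : Matrix (n ⊕ n) (n ⊕ n) K).det ≠ 0 := by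
    intro h0
    have := congrArg det (show (fromBlocks 0 1 1 0 : Matrix (n ⊕ n) (n ⊕ n) K) *
      fromBlocks 0 1 1 0 = 1 by simp [fromBlocks_multiply])
    simp [h0] at this
  have h' := congrArg det h
  rw [det_mul, det_mul, det_fromBlocks_zero₁₂, det_fromBlocks_zero₁₂, det_one, mul_one, mul_one,
    det_smul, det_smul, det_one, mul_one] at h'
  rw [← mul_eq_zero_iff_right h2, h']
  simp [hs]

/-- `λ ∈ ℂ` is an eigenvalue of the `l`-th Fourier-mode linearization `A_l` of the
cube-symmetric MDDE network iff `l²(1-λ)² = -c₁ + 2k c₂ - 2cos(lα)` for some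
`k ∈ {0, 1, 2, 3}`. -/
theorem mddeAl_eigenvalues (c₁ c₂ α : ℝ) (l : ℕ) (hl : 1 ≤ l) (lam : ℂ) :
    (mddeAl c₁ c₂ α l - lam • (1 : Matrix (Fin 8 ⊕ Fin 8) (Fin 8 ⊕ Fin 8) ℂ)).det = 0 ↔
    ∃ k : Fin 4, (l : ℂ) ^ 2 * (1 - lam) ^ 2
        = -(c₁ : ℂ) + 2 * ((k : ℕ) : ℂ) * (c₂ : ℂ) - 2 * ((Real.cos (l * α) : ℝ) : ℂ) := by
  have hl0 : (l : ℂ) ≠ 0 := by exact_mod_cast (by lia : l ≠ 0)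
  have hs : -(1 / (Complex.I * (l : ℂ))) ≠ 0 := by simp [hl0]
  have hs2 : (-(1 / (Complex.I * (l : ℂ)))) ^ 2 = -((l : ℂ) ^ 2)⁻¹ := by
    simp [mul_pow]
  have hA : mddeAl c₁ c₂ α l - lam • (1 : Matrix (Fin 8 ⊕ Fin 8) (Fin 8 ⊕ Fin 8) ℂ) =
      fromBlocks ((1 - lam) • 1) (-(1 / (Complex.I * (l : ℂ))) • 1)
        (-(1 / (Complex.I * (l : ℂ))) • mddeM c₁ c₂ α l) ((1 - lam) • 1) := by
    rw [mddeAl, ← fromBlocks_one, fromBlocks_smul, sub_eq_add_neg, fromBlocks_neg, fromBlocks_add]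
    simp only [smul_zero, neg_zero, add_zero, ← sub_eq_add_neg, sub_smul, one_smul]
  have hM : (1 - lam) ^ 2 • (1 : Matrix (Fin 8) (Fin 8) ℂ) -
      (-(1 / (Complex.I * (l : ℂ)))) ^ 2 • mddeM c₁ c₂ α l =
      ((l : ℂ) ^ 2)⁻¹ • (((l : ℂ) ^ 2 * (1 - lam) ^ 2 + c₁ +
        2 * ((Real.cos (l * α) : ℝ) : ℂ)) • (1 : Matrix (Fin 8) (Fin 8) ℂ) +
        (c₂ : ℂ) • cubeB) := by
    rw [hs2, mddeM]
    ext i j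
    simp only [Matrix.sub_apply, Matrix.add_apply, Matrix.smul_apply, smul_eq_mul]
    push_cast
    field_simp
    ring
  rw [hA, det_fromBlocks_smul_one_eq_zero_iff hs, hM, det_smul, det_smul_one_add_smul_cubeB,
    mul_eq_zero_iff_left (by simp [hl0]), Finset.prod_eq_zero_iff, cubeWeight_surjective.exists]
  simp only [Finset.mem_univ, true_and]
  refine exists_congr fun i => ?_
  constructor <;> intro h <;> linear_combination h
end
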